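/- Assume the reduced system is uncontrolled, y′(τ) = f(y(τ)), and Assumption III holds. Then there exists β(S) → 0 as S → ∞ such that sup_{μ∈W(z)} ρ(μ, M_z(S,y₀)) ≤ β(S) for all y₀ ∈ Y_z and all z ∈ Z. -/

import Mathlib

open MeasureTheory Set Filter Metric
open scoped ENNReal NNReal Topology

noncomputable section

namespace SlowObs

abbrev Dd (d : ℕ) := EuclideanSpace ℝ (Fin d)
abbrev Em (m : ℕ) := EuclideanSpace ℝ (Fin m)
abbrev Kk (k : ℕ) := EuclideanSpace ℝ (Fin k)

variable {d m k : ℕ}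

/-- A control: a measurable function with values in `U` at nonnegative times. -/
def IsControl (U : Set (Dd d)) (u : ℝ → Dd d) : Prop :=
  Measurable u ∧ ∀ t : ℝ, 0 ≤ t → u t ∈ U

/-- Carathéodory (integral-form) solution of `y'(t) = vf t (y t)` on `[0, ∞)`. -/
def IsSolOn (vf : ℝ → Em m → Em m) (y : ℝ → Em m) : Prop :=
  ContinuousOn y (Ici 0) ∧
    (∀ T : ℝ, IntervalIntegrable (fun s => vf s (y s)) volume 0 T) ∧
    ∀ t : ℝ, 0 ≤ t → y t = y 0 + ∫ s in (0:ℝ)..t, vf s (y s)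

/-- The level sets `Y_z = {y : F y = z}` (invariant sets of the reduced system). -/
def lvl (F : Em m → Kk k) (z : Kk k) : Set (Em m) := {y | F y = z}

/-- `h(u,y) := F'(y) g(u,y)`. -/
def hObs (F : Em m → Kk k) (g : Dd d → Em m → Em m) (p : Dd d × Em m) : Kk k :=
  fderiv ℝ F p.2 (g p.1 p.2)

/-- Occupational measure generated on `[0,S]` by the pair `(u(·), y(·))`:
the pushforward of the normalized Lebesgue measure on `[0,S]` under `τ ↦ (u τ, y τ)`. -/
def occ (u : ℝ → Dd d) (y : ℝ → Em m) (S : ℝ) : Measure (Dd d × Em m) :=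
  (ENNReal.ofReal S)⁻¹ • Measure.map (fun τ => (u τ, y τ)) (volume.restrict (Ioc 0 S))

/-- The set `W(z)`. -/
def W (U : Set (Dd d)) (f : Dd d → Em m → Em m) (F : Em m → Kk k) (z : Kk k) :
    Set (Measure (Dd d × Em m)) :=
  {μ | IsProbabilityMeasure μ ∧ μ (U ×ˢ lvl F z) = 1 ∧
    ∀ φ : Em m → ℝ, ContDiff ℝ 1 φ → ∫ p, fderiv ℝ φ p.2 (f p.1 p.2) ∂μ = 0}

/-- The metric `ρ` on probability measures: the Lévy–Prokhorov (extended) distance. -/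
def ρ (μ ν : Measure (Dd d × Em m)) : ℝ≥0∞ := levyProkhorovEDist μ ν

/-- Distance from a measure to a set of measures, `ρ(μ, Γ) = inf_{ν ∈ Γ} ρ(μ,ν)`. -/
def ρpt (μ : Measure (Dd d × Em m)) (Γ : Set (Measure (Dd d × Em m))) : ℝ≥0∞ :=
  ⨅ ν ∈ Γ, ρ μ ν

/-- The Hausdorff semimetric `ρ_H` on sets of measures. -/
def ρH (Γ₁ Γ₂ : Set (Measure (Dd d × Em m))) : ℝ≥0∞ :=
  max (⨆ μ ∈ Γ₁, ρpt μ Γ₂) (⨆ μ ∈ Γ₂, ρpt μ Γ₁)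

/-- Continuity of the set-valued map `z ↦ W(z)` on `Z` with respect to `ρ_H`. -/
def WCont (U : Set (Dd d)) (f : Dd d → Em m → Em m) (F : Em m → Kk k)
    (Z : Set (Kk k)) : Prop :=
  ∀ z ∈ Z, ∀ δ : ℝ≥0∞, 0 < δ → ∃ ε > (0:ℝ), ∀ z' ∈ Z, ‖z' - z‖ < ε →
    ρH (W U f F z') (W U f F z) < δ

/-- `h̃(μ) = ∫ h dμ`. -/
def htilde (F : Em m → Kk k) (g : Dd d → Em m → Em m) (μ : Measure (Dd d × Em m)) : Kk k :=
  ∫ p, hObs F g p ∂μ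

/-- `r̃(μ) = ∫ r dμ`. -/
def rtilde (r : Dd d → Em m → ℝ) (μ : Measure (Dd d × Em m)) : ℝ :=
  ∫ p, r p.1 p.2 ∂μ

/-- The set-valued map `V(z) = {(h̃ μ, r̃ μ) : μ ∈ W(z)} ⊆ ℝ^{k+1}`. -/
def Vmap (U : Set (Dd d)) (f : Dd d → Em m → Em m) (F : Em m → Kk k)
    (g : Dd d → Em m → Em m) (r : Dd d → Em m → ℝ) (z : Kk k) : Set (Kk k × ℝ) :=
  (fun μ => (htilde F g μ, rtilde r μ)) '' W U f F z

/-- Lipschitz continuity of `V` on `Z` in the Hausdorff metric. -/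
def VLip (U : Set (Dd d)) (f : Dd d → Em m → Em m) (F : Em m → Kk k)
    (g : Dd d → Em m → Em m) (r : Dd d → Em m → ℝ) (Z : Set (Kk k)) : Prop :=
  ∃ L : ℝ, 0 ≤ L ∧ ∀ z' ∈ Z, ∀ z'' ∈ Z,
    hausdorffDist (Vmap U f F g r z') (Vmap U f F g r z'') ≤ L * ‖z' - z''‖

/-- A solution `(μ(·), z(·))` of the averaged system with initial value `z₀`. -/
def IsAveragedSol (U : Set (Dd d)) (f : Dd d → Em m → Em m) (F : Em m → Kk k)
    (g : Dd d → Em m → Em m) (z₀ : Kk k)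
    (μt : ℝ → Measure (Dd d × Em m)) (z : ℝ → Kk k) : Prop :=
  z 0 = z₀ ∧ ContinuousOn z (Ici 0) ∧
    (∀ T : ℝ, IntervalIntegrable (fun s => htilde F g (μt s)) volume 0 T) ∧
    (∀ t : ℝ, 0 ≤ t → z t = z₀ + ∫ s in (0:ℝ)..t, htilde F g (μt s)) ∧
    (∀ t : ℝ, 0 ≤ t → μt t ∈ W U f F (z t))

/-- Viability of the averaged system in `Z`. -/
def AveragedViable (U : Set (Dd d)) (f : Dd d → Em m → Em m) (F : Em m → Kk k)
    (g : Dd d → Em m → Em m) (Z : Set (Kk k)) : Prop :=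
  ∀ z₀ ∈ Z, ∃ μt zf, IsAveragedSol U f F g z₀ μt zf ∧ ∀ t : ℝ, 0 ≤ t → zf t ∈ Z

/-- Viability of the augmented perturbed system in `Y × Z`. -/
def AugViable (U : Set (Dd d)) (f g : Dd d → Em m → Em m) (F : Em m → Kk k)
    (Yset : Set (Em m)) (Z : Set (Kk k)) : Prop :=
  ∀ ε > (0:ℝ), ∀ y₀ ∈ Yset, ∀ z₀ ∈ Z, ∃ u y zf,
    IsControl U u ∧ IsSolOn (fun s x => ε⁻¹ • f (u s) x + g (u s) x) y ∧ y 0 = y₀ ∧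
    ContinuousOn zf (Ici 0) ∧ zf 0 = z₀ ∧
    (∀ T : ℝ, IntervalIntegrable (fun s => hObs F g (u s, y s)) volume 0 T) ∧
    (∀ t : ℝ, 0 ≤ t → zf t = z₀ + ∫ s in (0:ℝ)..t, hObs F g (u s, y s)) ∧
    (∀ t : ℝ, 0 ≤ t → y t ∈ Yset ∧ zf t ∈ Z)

/-- The set `M_z(S, y₀)` of occupational measures on `[0,S]` of reduced solutions from `y₀`. -/
def Mz (U : Set (Dd d)) (f : Dd d → Em m → Em m) (S : ℝ) (y₀ : Em m) :
    Set (Measure (Dd d × Em m)) :=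
  {μ | ∃ u y, IsControl U u ∧ IsSolOn (fun s x => f (u s) x) y ∧ y 0 = y₀ ∧ μ = occ u y S}

/-- Assumption 2 of the paper: `sup_{μ ∈ W(z)} ρ(μ, M_z(S,y₀)) ≤ β(S) → 0`,
uniformly over `y₀ ∈ Y_z` and `z ∈ Z`. -/
def Assumption2 (U : Set (Dd d)) (f : Dd d → Em m → Em m) (F : Em m → Kk k)
    (Z : Set (Kk k)) : Prop :=
  ∃ β : ℝ → ℝ, Tendsto β atTop (𝓝 0) ∧
    ∀ z ∈ Z, ∀ y₀ ∈ lvl F z, ∀ S > (0:ℝ), ∀ μ ∈ W U f F z,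
      ρpt μ (Mz U f S y₀) ≤ ENNReal.ofReal (β S)

/-- Optimal value `R^*(ε, y₀)` of the perturbed problem (shrinked time scale). -/
def Rstar (U : Set (Dd d)) (f g : Dd d → Em m → Em m) (r : Dd d → Em m → ℝ)
    (C : ℝ) (y₀ : Em m) (ε : ℝ) : ℝ :=
  sInf {v | ∃ u y, IsControl U u ∧
    IsSolOn (fun s x => ε⁻¹ • f (u s) x + g (u s) x) y ∧ y 0 = y₀ ∧
    v = ∫ t in Ioi (0:ℝ), Real.exp (-C * t) * r (u t) (y t)}

/-- Optimal value `R̃^*` of the averaged problem. -/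
def RtildeStar (U : Set (Dd d)) (f : Dd d → Em m → Em m) (F : Em m → Kk k)
    (g : Dd d → Em m → Em m) (r : Dd d → Em m → ℝ) (C : ℝ) (z₀ : Kk k) : ℝ :=
  sInf {v | ∃ μt z, IsAveragedSol U f F g z₀ μt z ∧
    v = ∫ t in Ioi (0:ℝ), Real.exp (-C * t) * rtilde r (μt t)}

/-- Bilinear form `wᵀ Q v` of a matrix. -/
def matBil (Q : Matrix (Fin m) (Fin m) ℝ) (w v : Em m) : ℝ :=
  ∑ i, w i * Q.mulVec (fun j => v j) i

/-- The pair `(u(·), y(·))` generates the occupational measure `μ` on `[0,∞)`. -/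
def GeneratesOM (u : ℝ → Dd d) (y : ℝ → Em m) (μ : Measure (Dd d × Em m)) : Prop :=
  IsProbabilityMeasure μ ∧ ∀ q : Dd d × Em m → ℝ, Continuous q →
    Tendsto (fun S : ℝ => S⁻¹ * ∫ τ in (0:ℝ)..S, q (u τ, y τ)) atTop (𝓝 (∫ p, q p ∂μ))

/-- An average control generating (ACG) family `(u_z(·), y_z(·))` with occupational
measures `μ_z` and the (unique) solution `zsol` of `z'(t) = h̃(μ_{z(t)})`, `z 0 = z₀`. -/
def IsACG (U : Set (Dd d)) (f : Dd d → Em m → Em m) (F : Em m → Kk k)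
    (g : Dd d → Em m → Em m) (Z : Set (Kk k)) (z₀ : Kk k)
    (uz : Kk k → ℝ → Dd d) (yz : Kk k → ℝ → Em m)
    (μz : Kk k → Measure (Dd d × Em m)) (zsol : ℝ → Kk k) : Prop :=
  (∀ z ∈ Z, IsControl U (uz z)) ∧
  (∀ z ∈ Z, IsSolOn (fun s x => f (uz z s) x) (yz z)) ∧
  (∀ z ∈ Z, ∀ τ : ℝ, 0 ≤ τ → yz z τ ∈ lvl F z) ∧
  (∀ z ∈ Z, IsProbabilityMeasure (μz z)) ∧
  (∀ q : Dd d × Em m → ℝ, Continuous q →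
    ∃ αq : ℝ → ℝ, Tendsto αq atTop (𝓝 0) ∧ ∀ z ∈ Z, ∀ S > (0:ℝ),
      |S⁻¹ * (∫ τ in (0:ℝ)..S, q (uz z τ, yz z τ)) - ∫ p, q p ∂(μz z)| ≤ αq S) ∧
  (∀ q : Dd d × Em m → ℝ, Continuous q → Measurable fun z => ∫ p, q p ∂(μz z)) ∧
  zsol 0 = z₀ ∧ ContinuousOn zsol (Ici 0) ∧
  (∀ T : ℝ, IntervalIntegrable (fun s => htilde F g (μz (zsol s))) volume 0 T) ∧
  (∀ t : ℝ, 0 ≤ t → zsol t = z₀ + ∫ s in (0:ℝ)..t, htilde F g (μz (zsol s))) ∧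
  (∀ t : ℝ, 0 ≤ t → zsol t ∈ Z) ∧
  (∀ w : ℝ → Kk k, w 0 = z₀ → ContinuousOn w (Ici 0) →
    (∀ T : ℝ, IntervalIntegrable (fun s => htilde F g (μz (w s))) volume 0 T) →
    (∀ t : ℝ, 0 ≤ t → w t = z₀ + ∫ s in (0:ℝ)..t, htilde F g (μz (w s))) →
    (∀ t : ℝ, 0 ≤ t → w t ∈ Z) → ∀ t : ℝ, 0 ≤ t → w t = zsol t)

/-- Periodicity of an ACG family. -/
def ACGPeriodic (Z : Set (Kk k)) (uz : Kk k → ℝ → Dd d) (yz : Kk k → ℝ → Em m) : Prop :=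
  ∀ z ∈ Z, ∃ T > (0:ℝ), ∀ τ : ℝ, 0 ≤ τ →
    uz z (τ + T) = uz z τ ∧ yz z (τ + T) = yz z τ

/-- Optimality of an ACG family in the averaged problem. -/
def ACGOptimal (U : Set (Dd d)) (f : Dd d → Em m → Em m) (F : Em m → Kk k)
    (g : Dd d → Em m → Em m) (r : Dd d → Em m → ℝ) (C : ℝ) (z₀ : Kk k)
    (μz : Kk k → Measure (Dd d × Em m)) (zsol : ℝ → Kk k) : Prop :=
  (∫ t in Ioi (0:ℝ), Real.exp (-C * t) * rtilde r (μz (zsol t))) =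
    RtildeStar U f F g r C z₀

/-- The set `D̃(z₀)` of discounted occupational measures supported on the graph of `W`. -/
def Dtilde (U : Set (Dd d)) (f : Dd d → Em m → Em m) (F : Em m → Kk k)
    (g : Dd d → Em m → Em m) (Z : Set (Kk k)) (C : ℝ) (z₀ : Kk k) :
    Set (Measure (Measure (Dd d × Em m) × Kk k)) :=
  {p | IsProbabilityMeasure p ∧ p {q | q.2 ∈ Z ∧ q.1 ∈ W U f F q.2} = 1 ∧
    ∀ ψ : Kk k → ℝ, ContDiff ℝ 1 ψ →
      ∫ q, (fderiv ℝ ψ q.2 (htilde F g q.1) + C * (ψ z₀ - ψ q.2)) ∂p = 0}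

/-- `ã^*(z₀)`: the optimal value of the IDLP problem. -/
def astar (U : Set (Dd d)) (f : Dd d → Em m → Em m) (F : Em m → Kk k)
    (g : Dd d → Em m → Em m) (r : Dd d → Em m → ℝ) (Z : Set (Kk k)) (C : ℝ)
    (z₀ : Kk k) : ℝ :=
  sInf ((fun p => ∫ q, rtilde r q.1 ∂p) '' Dtilde U f F g Z C z₀)

/-- The Hamiltonian `H̃(p,z)` of the averaged system (`p` a linear functional). -/
def Htilde (U : Set (Dd d)) (f : Dd d → Em m → Em m) (F : Em m → Kk k)
    (g : Dd d → Em m → Em m) (r : Dd d → Em m → ℝ) (p : Kk k →L[ℝ] ℝ) (z : Kk k) : ℝ :=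
  sInf ((fun μ => rtilde r μ + p (htilde F g μ)) '' W U f F z)

/-- Assumption V: existence of solutions `ζ*` of the averaged dual problem and `η*_z`
of the associated dual problems. -/
def AssumptionV (U : Set (Dd d)) (f : Dd d → Em m → Em m) (F : Em m → Kk k)
    (g : Dd d → Em m → Em m) (r : Dd d → Em m → ℝ) (Z : Set (Kk k)) (C : ℝ)
    (z₀ : Kk k) (ζs : Kk k → ℝ) (ηs : Kk k → Em m → ℝ) : Prop :=
  ContDiff ℝ 1 ζs ∧ (∀ z, ContDiff ℝ 1 (ηs z)) ∧
  IsLeast ((fun z => Htilde U f F g r (fderiv ℝ ζs z) z + C * (ζs z₀ - ζs z)) '' Z)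
    (astar U f F g r Z C z₀) ∧
  ∀ z ∈ Z, IsLeast
    ((fun p : Dd d × Em m =>
        r p.1 p.2 + fderiv ℝ ζs z (hObs F g p) + fderiv ℝ (ηs z) p.2 (f p.1 p.2)) ''
      (U ×ˢ lvl F z))
    (Htilde U f F g r (fderiv ℝ ζs z) z)

/-- The occupational measure of a `T`-periodic orbit `y(·)` (a measure on the state space). -/
def perOcc (y : ℝ → Em m) (T : ℝ) : Measure (Em m) :=
  (ENNReal.ofReal T)⁻¹ • Measure.map y (volume.restrict (Ioc 0 T))

/-- Assumption III: for each `z ∈ Z`, the uncontrolled reduced system has a `T_z`-periodic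
solution in `Y_z` (periods uniformly bounded), and every solution starting in `Y_z`
is a time shift of it. -/
def AssumptionIII (f0 : Em m → Em m) (F : Em m → Kk k) (Z : Set (Kk k))
    (yper : Kk k → ℝ → Em m) (Tper : Kk k → ℝ) : Prop :=
  (∃ T₀ : ℝ, ∀ z ∈ Z, 0 < Tper z ∧ Tper z ≤ T₀) ∧
  (∀ z ∈ Z, IsSolOn (fun _ x => f0 x) (yper z)) ∧
  (∀ z ∈ Z, ∀ τ : ℝ, yper z τ ∈ lvl F z) ∧
  (∀ z ∈ Z, ∀ τ : ℝ, yper z (τ + Tper z) = yper z τ) ∧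
  (∀ z ∈ Z, ∀ y : ℝ → Em m, IsSolOn (fun _ x => f0 x) y → y 0 ∈ lvl F z →
    ∃ s : ℝ, ∀ τ : ℝ, 0 ≤ τ → y τ = yper z (τ + s))

/-- Assumption IV: existence, for each `z ∈ Z`, of a solution `ȳ_z` generating an
occupational measure `ν_z`, which asymptotically attracts (up to time shifts) every
solution staying in `Y_z`. -/
def AssumptionIV (f0 : Em m → Em m) (F : Em m → Kk k) (Z : Set (Kk k))
    (ybar : Kk k → ℝ → Em m) (ν : Kk k → Measure (Em m)) : Prop :=
  (∀ z ∈ Z, IsSolOn (fun _ x => f0 x) (ybar z)) ∧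
  (∀ z ∈ Z, ∀ τ : ℝ, 0 ≤ τ → ybar z τ ∈ lvl F z) ∧
  (∀ z ∈ Z, IsProbabilityMeasure (ν z) ∧ ν z (lvl F z) = 1) ∧
  (∀ q : Em m → ℝ, Continuous q → ∃ κ : ℝ → ℝ, Tendsto κ atTop (𝓝 0) ∧
    ∀ z ∈ Z, ∀ S > (0:ℝ),
      |S⁻¹ * (∫ τ in (0:ℝ)..S, q (ybar z τ)) - ∫ x, q x ∂(ν z)| ≤ κ S) ∧
  (∃ α₁ α₂ : ℝ → ℝ, Tendsto α₁ atTop (𝓝 0) ∧ Tendsto α₂ atTop (𝓝 0) ∧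
    (∀ S > (0:ℝ), 0 < α₁ S ∧ 0 < α₂ S) ∧
    ∀ z ∈ Z, ∀ y : ℝ → Em m, IsSolOn (fun _ x => f0 x) y →
      (∀ τ : ℝ, 0 ≤ τ → y τ ∈ lvl F z) → ∀ S > (0:ℝ),
        ∃ θ : ℝ, 0 ≤ θ ∧ θ / S ≤ α₂ S ∧
          ∀ τ ∈ Icc (0:ℝ) S, ‖y (τ + θ) - ybar z τ‖ ≤ α₁ S)

section Flow

variable {E : Type*} [NormedAddCommGroup E] [NormedSpace ℝ E]
  {f : E → E} {L : ℝ≥0}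

/-- `y` is continuous and solves the integral equation of the flow of `f` started at `x` on `[0, T]`. -/
def IsIntegralSol (f : E → E) (x : E) (T : ℝ) (y : ℝ → E) : Prop :=
  Continuous y ∧ ∀ t ∈ Icc 0 T, y t = x + ∫ s in (0:ℝ)..t, f (y s)

theorem IsIntegralSol.mono {x : E} {T T' : ℝ} {y : ℝ → E} (h : IsIntegralSol f x T y)
    (hT : T' ≤ T) : IsIntegralSol f x T' y :=
  ⟨h.1, fun t ht => h.2 t ⟨ht.1, ht.2.trans hT⟩⟩

theorem IsIntegralSol.hasDerivWithinAt [CompleteSpace E] (hf : LipschitzWith L f)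
    {x : E} {T : ℝ} {y : ℝ → E}
    (h : IsIntegralSol f x T y) {t : ℝ} (ht : t ∈ Ico 0 T) :
    HasDerivWithinAt y (f (y t)) (Ici t) t := by
  have hc : Continuous fun s => f (y s) := hf.continuous.comp h.1
  have h1 : HasDerivAt (fun t => x + ∫ s in (0:ℝ)..t, f (y s)) (f (y t)) t :=
    (hc.integral_hasStrictDerivAt 0 t).hasDerivAt.const_add x
  refine h1.hasDerivWithinAt.congr_of_eventuallyEq ?_ (h.2 t ⟨ht.1, ht.2.le⟩)
  filter_upwards [inter_mem_nhdsWithin (Ici t) (Iio_mem_nhds ht.2)] with s hs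
  exact h.2 s ⟨ht.1.trans hs.1, le_of_lt hs.2⟩

theorem IsIntegralSol.dist_le [CompleteSpace E] (hf : LipschitzWith L f)
    {x x' : E} {T : ℝ} {y y' : ℝ → E}
    (h : IsIntegralSol f x T y) (h' : IsIntegralSol f x' T y') {t : ℝ} (ht : t ∈ Icc 0 T) :
    dist (y t) (y' t) ≤ dist x x' * Real.exp (L * t) := by
  have h0 : (0:ℝ) ∈ Icc 0 T := ⟨le_rfl, ht.1.trans ht.2⟩
  have := dist_le_of_trajectories_ODE (v := fun _ => f) (K := L) (f := y) (g := y')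
    (a := 0) (b := T) (δ := dist x x') (fun _ => hf) h.1.continuousOn
    (fun t ht => h.hasDerivWithinAt hf ht) h'.1.continuousOn
    (fun t ht => h'.hasDerivWithinAt hf ht)
    (by rw [h.2 0 h0, h'.2 0 h0]; simp) t ht
  simpa using this

theorem exists_isIntegralSol_one_div [CompleteSpace E] (hf : LipschitzWith L f) (x : E) :
    ∃ y, IsIntegralSol f x (1 / (1 + L)) y := by
  set τ : ℝ := 1 / (1 + L) with hτ
  have hτ0 : 0 < τ := by positivity
  set a : ℝ≥0 := ‖f x‖₊ with ha
  have hP : IsPicardLindelof (fun _ => f) (tmin := 0) (tmax := τ) ⟨0, le_rfl, hτ0.le⟩ x a 0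
      ((1 + L) * a) L := by
    refine IsPicardLindelof.of_time_independent (fun z hz => ?_) hf.lipschitzOnWith ?_
    · have h1 := hf.dist_le_mul z x
      have h2 : dist z x ≤ a := hz
      have h3 : ‖f z‖ ≤ ‖f x‖ + dist (f z) (f x) := by
        rw [dist_eq_norm]
        simpa using norm_add_le (f x) (f z - f x)
      have h4 : (L : ℝ) * dist z x ≤ L * a := by gcongr
      have h5 : (a : ℝ) = ‖f x‖ := rfl
      push_cast
      linarith
    · simp only [sub_zero, sub_self, NNReal.coe_zero]
      rw [max_eq_left hτ0.le, hτ]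
      push_cast
      have : (1 + (L : ℝ)) ≠ 0 := by positivity
      field_simp
      exact le_rfl
  obtain ⟨α, h0, hα⟩ := hP.exists_eq_forall_mem_Icc_hasDerivWithinAt₀
  have h0' : α 0 = x := h0
  have hcα : ContinuousOn α (Icc 0 τ) := HasDerivWithinAt.continuousOn hα
  refine ⟨IccExtend hτ0.le ((Icc 0 τ).domRestrict α), hcα.domRestrict.Icc_extend', fun t ht => ?_⟩
  have key : ∀ s ∈ Icc 0 τ, IccExtend hτ0.le ((Icc 0 τ).domRestrict α) s = α s := fun s hs => by
    rw [IccExtend_of_mem _ _ hs]; rfl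
  rw [key t ht]
  have hI : ∫ s in (0:ℝ)..t, f (IccExtend hτ0.le ((Icc 0 τ).domRestrict α) s)
      = ∫ s in (0:ℝ)..t, f (α s) := by
    refine intervalIntegral.integral_congr fun s hs => ?_
    rw [uIcc_of_le ht.1] at hs
    simp only [key s ⟨hs.1, hs.2.trans ht.2⟩]
  rw [hI, intervalIntegral.integral_eq_sub_of_hasDeriv_right (f := α)]
  · simp [h0']
  · rw [uIcc_of_le ht.1]; exact hcα.mono (Icc_subset_Icc_right ht.2)
  · intro s hs
    rw [min_eq_left ht.1, max_eq_right ht.1] at hs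
    refine ((hα s ⟨hs.1.le, hs.2.le.trans ht.2⟩).hasDerivAt
      (Icc_mem_nhds hs.1 (hs.2.trans_le ht.2))).hasDerivWithinAt
  · refine ContinuousOn.intervalIntegrable ?_
    rw [uIcc_of_le ht.1]
    exact hf.continuous.comp_continuousOn (hcα.mono (Icc_subset_Icc_right ht.2))

theorem IsIntegralSol.append (hf : Continuous f) {x : E} {S T : ℝ} {y z : ℝ → E} (hS : 0 ≤ S)
    (hT : 0 ≤ T) (hy : IsIntegralSol f x S y) (hz : IsIntegralSol f (y S) T z) :
    IsIntegralSol f x (S + T) (fun t => y (min t S) + (z (max (t - S) 0) - y S)) := by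
  have hz0 : z 0 = y S := by simpa using hz.2 0 ⟨le_rfl, hT⟩
  have hle : ∀ t ≤ S, y (min t S) + (z (max (t - S) 0) - y S) = y t := fun t ht => by
    rw [min_eq_left ht, max_eq_right (by linarith), hz0]; simp
  have hge : ∀ t, S ≤ t → y (min t S) + (z (max (t - S) 0) - y S) = z (t - S) := fun t ht => by
    rw [min_eq_right ht, max_eq_left (by linarith)]; abel
  have hyc := hy.1
  have hzc := hz.1
  have hc : Continuous (fun t => y (min t S) + (z (max (t - S) 0) - y S)) := by fun_prop
  refine ⟨hc, fun t ht => ?_⟩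
  have hcong : ∀ t ∈ Icc 0 S, ∫ s in (0:ℝ)..t, f (y (min s S) + (z (max (s - S) 0) - y S))
      = ∫ s in (0:ℝ)..t, f (y s) := fun t ht => by
    refine intervalIntegral.integral_congr fun s hs => ?_
    rw [uIcc_of_le ht.1] at hs
    simp only [hle s (hs.2.trans ht.2)]
  rcases le_total t S with h | h
  · simp only [hle t h]
    rw [hcong t ⟨ht.1, h⟩]
    exact hy.2 t ⟨ht.1, h⟩
  · simp only [hge t h]
    have hfc : Continuous fun t => f (y (min t S) + (z (max (t - S) 0) - y S)) := hf.comp hc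
    rw [← intervalIntegral.integral_add_adjacent_intervals (b := S)
      (hfc.intervalIntegrable _ _) (hfc.intervalIntegrable _ _), hcong S ⟨hS, le_rfl⟩, ← add_assoc,
      ← hy.2 S ⟨hS, le_rfl⟩, hz.2 (t - S) ⟨by linarith, by linarith [ht.2]⟩]
    congr 1
    have h1 : ∫ s in S..t, f (y (min s S) + (z (max (s - S) 0) - y S))
        = ∫ s in S..t, f (z (s - S)) := by
      refine intervalIntegral.integral_congr fun s hs => ?_
      rw [uIcc_of_le h] at hs
      simp only [hge s hs.1]
    rw [h1, intervalIntegral.integral_comp_sub_right (fun s => f (z s))]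
    simp

theorem exists_isIntegralSol [CompleteSpace E] (hf : LipschitzWith L f) (T : ℝ) (x : E) :
    ∃ y, IsIntegralSol f x T y := by
  have hτ0 : (0:ℝ) < 1 / (1 + L) := by positivity
  have key : ∀ (n : ℕ) (x : E), ∃ y, IsIntegralSol f x (n * (1 / (1 + L))) y := by
    intro n
    induction n with
    | zero =>
      intro x
      refine ⟨fun _ => x, continuous_const, fun t ht => ?_⟩
      have : t = 0 := le_antisymm (by simpa using ht.2) ht.1
      simp [this]
    | succ n ih =>
      intro x
      obtain ⟨y, hy⟩ := ih x
      obtain ⟨z, hz⟩ := exists_isIntegralSol_one_div hf (y (n * (1 / (1 + L))))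
      refine ⟨_, (hy.append hf.continuous (by positivity) hτ0.le hz).mono (le_of_eq ?_)⟩
      push_cast
      ring
  obtain ⟨n, hn⟩ := exists_nat_ge (T / (1 / (1 + L)))
  obtain ⟨y, hy⟩ := key n x
  exact ⟨y, hy.mono (by rwa [div_le_iff₀ hτ0] at hn)⟩

/-- The forward semiflow of a globally Lipschitz vector field. -/
structure IsSemiflow (f : E → E) (L : ℝ≥0) (Φ : ℝ → E → E) : Prop where
  continuous : ∀ x, Continuous fun t => Φ t x
  eq_integral : ∀ x t, 0 ≤ t → Φ t x = x + ∫ s in (0:ℝ)..t, f (Φ s x)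
  dist_le : ∀ x x' t, 0 ≤ t → dist (Φ t x) (Φ t x') ≤ dist x x' * Real.exp (L * t)
  comp : ∀ x s t, 0 ≤ s → 0 ≤ t → Φ s (Φ t x) = Φ (s + t) x

theorem exists_isSemiflow [CompleteSpace E] (hf : LipschitzWith L f) : ∃ Φ, IsSemiflow f L Φ := by
  choose Y hY using fun (n : ℕ) (x : E) => exists_isIntegralSol hf (n : ℝ) x
  have hcompat : ∀ (n m : ℕ) (x : E) (t : ℝ), 0 ≤ t → t ≤ n → t ≤ m → Y n x t = Y m x t := by
    intro n m x t h0 hn hm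
    have := ((hY n x).mono hn).dist_le hf ((hY m x).mono hm) ⟨h0, le_rfl⟩
    rwa [dist_self, zero_mul, dist_le_zero] at this
  set Φ : ℝ → E → E := fun t x => Y ⌈t⌉₊ x (max t 0) with hΦ
  have hΦn : ∀ (n : ℕ) (x : E) (t : ℝ), t ≤ n → Φ t x = Y n x (max t 0) := fun n x t ht =>
    hcompat _ _ x _ (le_max_right _ _) (max_le (Nat.le_ceil t) (Nat.cast_nonneg _))
      (max_le ht (Nat.cast_nonneg _))
  have hc : ∀ x, Continuous fun t => Φ t x := fun x => by
    refine continuous_iff_continuousAt.2 fun t => ?_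
    obtain ⟨n, hn⟩ := exists_nat_gt t
    have h1 : Continuous fun t : ℝ => Y n x (max t 0) :=
      (hY n x).1.comp (continuous_id.max continuous_const)
    refine h1.continuousAt.congr ?_
    filter_upwards [Iio_mem_nhds hn] with s hs
    exact (hΦn n x s (le_of_lt hs)).symm
  have hsol : ∀ x T, IsIntegralSol f x T fun t => Φ t x := fun x T => by
    refine ⟨hc x, fun t ht => ?_⟩
    obtain ⟨n, hn⟩ := exists_nat_ge t
    beta_reduce
    rw [hΦn n x t hn, max_eq_left ht.1, (hY n x).2 t ⟨ht.1, hn⟩]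
    congr 1
    refine intervalIntegral.integral_congr fun s hs => ?_
    rw [uIcc_of_le ht.1] at hs
    simp only [hΦn n x s (hs.2.trans hn), max_eq_left hs.1]
  refine ⟨Φ, hc, fun x t ht => (hsol x t).2 t ⟨ht, le_rfl⟩,
    fun x x' t ht => (hsol x t).dist_le hf (hsol x' t) ⟨ht, le_rfl⟩, fun x s t hs ht => ?_⟩
  have h1 : IsIntegralSol f (Φ t x) s fun r => Φ (r + t) x := by
    refine ⟨(hc x).comp (continuous_add_const t), fun r hr => ?_⟩
    have hfc : Continuous fun s => f (Φ s x) := hf.continuous.comp (hc x)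
    have h2 := (hsol x (r + t)).2 (r + t) ⟨add_nonneg hr.1 ht, le_rfl⟩
    have h3 := (hsol x t).2 t ⟨ht, le_rfl⟩
    beta_reduce at h2 h3 ⊢
    rw [h2, h3,
      intervalIntegral.integral_comp_add_right (fun s => f (Φ s x)), zero_add, add_assoc,
      intervalIntegral.integral_add_adjacent_intervals
      (hfc.intervalIntegrable _ _) (hfc.intervalIntegrable _ _)]
  have := (hsol (Φ t x) s).dist_le hf h1 ⟨hs, le_rfl⟩
  rwa [dist_self, zero_mul, dist_le_zero] at this

end Flow

section Invariance

variable {E : Type*} [NormedAddCommGroup E] [NormedSpace ℝ E]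

/-- A mollified function almost satisfies a directional-derivative identity that the original one
satisfies, up to `C`, at the level of difference quotients. -/
theorem exists_contDiff_abs_fderiv_sub_le [FiniteDimensional ℝ E] [MeasurableSpace E]
    [BorelSpace E] {f : E → E} {χ g : E → ℝ} {C ε : ℝ} (hχ : Continuous χ) (hε : 0 < ε)
    (h : ∀ x, ∀ᶠ r : ℝ in 𝓝[>] 0, ∀ v ∈ ball x ε, |χ (v + r • f x) - χ v - r * g x| ≤ C * r) :
    ∃ φ : E → ℝ, ContDiff ℝ 1 φ ∧ ∀ x, |fderiv ℝ φ x (f x) - g x| ≤ C := by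
  let μ : Measure E := Measure.addHaar
  let η : ContDiffBump (0 : E) := ⟨ε / 2, ε, by positivity, by linarith⟩
  let φ : E → ℝ := MeasureTheory.convolution (η.normed μ) χ (ContinuousLinearMap.mul ℝ ℝ) μ
  have hφ : ∀ x, φ x = ∫ w, η.normed μ w * χ (x - w) ∂μ := fun x => by
    simp [φ, MeasureTheory.convolution_def]
  have hφd : ContDiff ℝ 1 φ :=
    η.hasCompactSupport_normed.contDiff_convolution_left _ η.contDiff_normed
      hχ.locallyIntegrable
  have hint : ∀ x, Integrable (fun w => η.normed μ w * χ (x - w)) μ := fun x =>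
    (η.continuous_normed.mul (by fun_prop)).integrable_of_hasCompactSupport
      η.hasCompactSupport_normed.mul_right
  refine ⟨φ, hφd, fun x => ?_⟩
  have hquot : ∀ᶠ r : ℝ in 𝓝[>] 0, |r⁻¹ • (φ (x + r • f x) - φ x) - g x| ≤ C := by
    filter_upwards [h x, self_mem_nhdsWithin] with r hr (hr0 : 0 < r)
    have h1 : φ (x + r • f x) - φ x - r * g x
        = ∫ w, η.normed μ w * (χ (x - w + r • f x) - χ (x - w) - r * g x) ∂μ := by
      have h2 : ∫ w, η.normed μ w * (r * g x) ∂μ = r * g x := by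
        rw [integral_mul_const, η.integral_normed, one_mul]
      have h3 : Integrable (fun w => η.normed μ w * χ (x + r • f x - w)
          - η.normed μ w * χ (x - w)) μ := (hint _).sub (hint _)
      simp only [mul_sub, sub_add_eq_add_sub]
      rw [integral_sub h3 (η.integrable_normed.mul_const _),
        integral_sub (hint _) (hint _), h2, hφ, hφ]
    have h3 : |φ (x + r • f x) - φ x - r * g x| ≤ C * r := by
      rw [h1, ← Real.norm_eq_abs]
      calc _ ≤ ∫ w, η.normed μ w * (C * r) ∂μ := by
            refine norm_integral_le_of_norm_le (η.integrable_normed.mul_const _)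
              (.of_forall fun w => ?_)
            rw [Real.norm_eq_abs, abs_mul, abs_of_nonneg (η.nonneg_normed w)]
            by_cases hw : η.normed μ w = 0
            · simp [hw]
            · refine mul_le_mul_of_nonneg_left (hr _ ?_) (η.nonneg_normed w)
              have : w ∈ ball (0 : E) ε := by
                rw [← η.support_normed_eq (μ := μ)]; exact hw
              simpa [mem_ball, dist_eq_norm] using this
        _ = C * r := by rw [integral_mul_const, η.integral_normed, one_mul]
    have h4 : r⁻¹ • (φ (x + r • f x) - φ x) - g x
        = (φ (x + r • f x) - φ x - r * g x) / r := by
      rw [smul_eq_mul]; field_simp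
    rw [h4, abs_div, abs_of_pos hr0, div_le_iff₀ hr0]
    exact h3
  have hlim : Tendsto (fun r : ℝ => r⁻¹ • (φ (x + r • f x) - φ x)) (𝓝[>] 0)
      (𝓝 (fderiv ℝ φ x (f x))) :=
    ((hφd.differentiable one_ne_zero x).hasFDerivAt.hasLineDerivAt
      (f x)).tendsto_slope_zero_right
  exact le_of_tendsto (hlim.sub_const _).abs hquot

variable {f : E → E} {L : ℝ≥0} {Φ : ℝ → E → E}

theorem IsSemiflow.zero_apply (hΦ : IsSemiflow f L Φ) (x : E) : Φ 0 x = x := by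
  simpa using hΦ.eq_integral x 0 le_rfl

theorem IsSemiflow.continuous_apply (hΦ : IsSemiflow f L Φ) {t : ℝ} (ht : 0 ≤ t) :
    Continuous (Φ t) := by
  refine LipschitzWith.continuous (K := (Real.exp (L * t)).toNNReal)
    (LipschitzWith.of_dist_le_mul fun x y => ?_)
  rw [Real.coe_toNNReal _ (Real.exp_pos _).le, mul_comm]
  exact hΦ.dist_le x y t ht

/-- The time average of a Lipschitz function along the semiflow has approximate derivative
`φ ∘ Φ a - φ` in the direction `f`. -/
theorem IsSemiflow.eventually_abs_sub_le [CompleteSpace E] (hΦ : IsSemiflow f L Φ)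
    (hf : LipschitzWith L f)
    {φ : E → ℝ} {K : ℝ≥0} (hφ : LipschitzWith K φ) {a : ℝ} (ha : 0 ≤ a) {ε : ℝ} (hε : 0 < ε)
    (x : E) :
    ∀ᶠ r : ℝ in 𝓝[>] 0, ∀ v ∈ ball x ε,
      |(∫ s in (0:ℝ)..a, φ (Φ s (v + r • f x))) - (∫ s in (0:ℝ)..a, φ (Φ s v))
        - r * (φ (Φ a x) - φ x)|
      ≤ (K * Real.exp (L * (a + 1)) * (2 * a * L * Real.exp (L * (a + 1)) + 4) * ε) * r := by
  set M := Real.exp (L * (a + 1)) with hM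
  have hM1 : 1 ≤ M := Real.one_le_exp (by positivity)
  have hexp : ∀ s ≤ a + 1, Real.exp (L * s) ≤ M := fun s hs =>
    Real.exp_le_exp.2 (by gcongr)
  have hcont : ∀ b, ∀ᶠ s in 𝓝 (0:ℝ), dist (Φ (b + s) x) (Φ b x) < ε := fun b => by
    have h1 : Tendsto (fun s => Φ (b + s) x) (𝓝 0) (𝓝 (Φ (b + 0) x)) :=
      ((hΦ.continuous x).comp (continuous_const_add b)).tendsto 0
    rw [add_zero] at h1
    exact h1 (ball_mem_nhds _ hε)
  obtain ⟨δ, hδ, hball⟩ := Metric.eventually_nhds_iff.1 ((hcont 0).and (hcont a))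
  filter_upwards [Ioo_mem_nhdsGT (lt_min hδ one_pos)] with r hr v hv
  have hr0 : 0 < r := hr.1
  have hr1 : r < 1 := hr.2.trans_le (min_le_right _ _)
  have hvx : dist v x < ε := hv
  have hcφ : ∀ w, Continuous fun s => φ (Φ s w) := fun w => hφ.continuous.comp (hΦ.continuous w)
  have hcf : ∀ w, Continuous fun s => f (Φ s w) := fun w => hf.continuous.comp (hΦ.continuous w)
  have hclose : ∀ b, 0 ≤ b → b ≤ a → (∀ s, dist s 0 < δ → dist (Φ (b + s) x) (Φ b x) < ε) →
      ∀ s ∈ Ioc 0 r, dist (Φ (b + s) v) (Φ b x) ≤ 2 * ε * M := by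
    intro b hb0 hba hb s hs
    have h1 : dist (Φ (b + s) x) (Φ b x) < ε := hb s (by
      rw [dist_zero_right, Real.norm_eq_abs, abs_of_pos hs.1]
      exact hs.2.trans_lt (hr.2.trans_le (min_le_left _ _)))
    have h2 : dist (Φ (b + s) v) (Φ (b + s) x) ≤ ε * M :=
      (hΦ.dist_le v x _ (by linarith [hs.1])).trans
        (mul_le_mul hvx.le (hexp _ (by linarith [hs.2])) (Real.exp_pos _).le hε.le)
    have h3 : ε ≤ ε * M := le_mul_of_one_le_right hε.le hM1
    linarith [dist_triangle (Φ (b + s) v) (Φ (b + s) x) (Φ b x)]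
  have hclose0 : ∀ s ∈ Ioc 0 r, dist (Φ s v) x ≤ 2 * ε * M := fun s hs => by
    have := hclose 0 le_rfl ha (fun s hs => (hball hs).1) s hs
    rwa [zero_add, hΦ.zero_apply] at this
  have hclosea := hclose a ha le_rfl (fun s hs => (hball hs).2)
  have hstep : dist (v + r • f x) (Φ r v) ≤ L * (2 * ε * M) * r := by
    have h1 : v + r • f x - Φ r v = ∫ s in (0:ℝ)..r, (f x - f (Φ s v)) := by
      rw [intervalIntegral.integral_sub (continuous_const.intervalIntegrable _ _)
        ((hcf v).intervalIntegrable _ _), hΦ.eq_integral v r hr0.le]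
      simp
    rw [dist_eq_norm, h1]
    refine (intervalIntegral.norm_integral_le_of_norm_le_const
      (C := L * (2 * ε * M)) fun s hs => ?_).trans_eq ?_
    · rw [uIoc_of_le hr0.le] at hs
      rw [← dist_eq_norm, dist_comm]
      exact (hf.dist_le_mul _ _).trans (by gcongr; exact hclose0 s hs)
    · rw [sub_zero, abs_of_pos hr0]
  have hA : |(∫ s in (0:ℝ)..a, φ (Φ s (v + r • f x))) - ∫ s in (0:ℝ)..a, φ (Φ s (Φ r v))|
      ≤ K * (L * (2 * ε * M) * r * M) * a := by
    rw [← intervalIntegral.integral_sub ((hcφ _).intervalIntegrable _ _)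
      ((hcφ _).intervalIntegrable _ _), ← Real.norm_eq_abs]
    refine (intervalIntegral.norm_integral_le_of_norm_le_const
      (C := K * (L * (2 * ε * M) * r * M)) fun s hs => ?_).trans_eq ?_
    · rw [uIoc_of_le ha] at hs
      rw [← dist_eq_norm]
      refine (hφ.dist_le_mul _ _).trans ?_
      gcongr
      refine (hΦ.dist_le _ _ s hs.1.le).trans ?_
      gcongr
      exact hexp s (by linarith [hs.2])
    · rw [sub_zero, abs_of_nonneg ha]
  have hB : |(∫ s in (0:ℝ)..a, φ (Φ s (Φ r v))) - (∫ s in (0:ℝ)..a, φ (Φ s v))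
      - r * (φ (Φ a x) - φ x)| ≤ 2 * (K * (2 * ε * M)) * r := by
    have h1 : ∫ s in (0:ℝ)..a, φ (Φ s (Φ r v)) = ∫ s in r..(a + r), φ (Φ s v) := by
      have h2 : ∫ s in (0:ℝ)..a, φ (Φ s (Φ r v)) = ∫ s in (0:ℝ)..a, φ (Φ (s + r) v) := by
        refine intervalIntegral.integral_congr fun s hs => ?_
        rw [uIcc_of_le ha] at hs
        simp only [hΦ.comp v s r hs.1 hr0.le]
      rw [h2, intervalIntegral.integral_comp_add_right (fun s => φ (Φ s v)), zero_add]
    have hi : ∀ b c, IntervalIntegrable (fun s => φ (Φ s v)) volume b c :=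
      fun b c => (hcφ v).intervalIntegrable b c
    have h3 : (∫ s in r..(a + r), φ (Φ s v)) - ∫ s in (0:ℝ)..a, φ (Φ s v)
        = (∫ s in (0:ℝ)..r, φ (Φ (a + s) v)) - ∫ s in (0:ℝ)..r, φ (Φ s v) := by
      rw [intervalIntegral.integral_comp_add_left (fun s => φ (Φ s v)), add_zero]
      have e1 := intervalIntegral.integral_add_adjacent_intervals (hi 0 r) (hi r (a + r))
      have e2 := intervalIntegral.integral_add_adjacent_intervals (hi 0 a) (hi a (a + r))
      linarith
    have h4 : r * (φ (Φ a x) - φ x) = ∫ s in (0:ℝ)..r, (φ (Φ a x) - φ x) := by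
      rw [intervalIntegral.integral_const, sub_zero, smul_eq_mul]
    have hca : Continuous fun s => φ (Φ (a + s) v) := (hcφ v).comp (continuous_const_add a)
    rw [h1, h3, h4, ← intervalIntegral.integral_sub (hca.intervalIntegrable _ _) (hi _ _),
      ← intervalIntegral.integral_sub (f := fun s => φ (Φ (a + s) v) - φ (Φ s v))
        ((hca.sub (hcφ v)).intervalIntegrable _ _)
        (continuous_const.intervalIntegrable _ _), ← Real.norm_eq_abs]
    refine (intervalIntegral.norm_integral_le_of_norm_le_const
      (C := 2 * (K * (2 * ε * M))) fun s hs => ?_).trans_eq ?_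
    · rw [uIoc_of_le hr0.le] at hs
      have e1 : |φ (Φ (a + s) v) - φ (Φ a x)| ≤ K * (2 * ε * M) :=
        (hφ.dist_le_mul _ _).trans (by gcongr; exact hclosea s hs)
      have e2 : |φ (Φ s v) - φ x| ≤ K * (2 * ε * M) :=
        (hφ.dist_le_mul _ _).trans (by gcongr; exact hclose0 s hs)
      rw [Real.norm_eq_abs, abs_le]
      rw [abs_le] at e1 e2
      constructor <;> linarith
    · rw [sub_zero, abs_of_pos hr0]
  have htri := abs_add_le ((∫ s in (0:ℝ)..a, φ (Φ s (v + r • f x)))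
    - ∫ s in (0:ℝ)..a, φ (Φ s (Φ r v))) ((∫ s in (0:ℝ)..a, φ (Φ s (Φ r v)))
    - (∫ s in (0:ℝ)..a, φ (Φ s v)) - r * (φ (Φ a x) - φ x))
  rw [show ∀ p q t u : ℝ, p - q + (q - t - u) = p - t - u by intros; ring] at htri
  calc _ ≤ _ := htri
    _ ≤ _ := add_le_add hA hB
    _ = _ := by ring

theorem IsSemiflow.continuous_integral (hΦ : IsSemiflow f L Φ) {φ : E → ℝ} {K : ℝ≥0}
    (hφ : LipschitzWith K φ) {a : ℝ} (ha : 0 ≤ a) :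
    Continuous fun x => ∫ s in (0:ℝ)..a, φ (Φ s x) := by
  have hcφ : ∀ w, Continuous fun s => φ (Φ s w) := fun w => hφ.continuous.comp (hΦ.continuous w)
  refine LipschitzWith.continuous (K := K * (Real.exp (L * a)).toNNReal * a.toNNReal)
    (LipschitzWith.of_dist_le_mul fun x y => ?_)
  rw [Real.dist_eq, ← intervalIntegral.integral_sub ((hcφ _).intervalIntegrable _ _)
      ((hcφ _).intervalIntegrable _ _), ← Real.norm_eq_abs]
  push_cast
  rw [Real.coe_toNNReal _ (Real.exp_pos _).le, Real.coe_toNNReal _ ha]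
  refine (intervalIntegral.norm_integral_le_of_norm_le_const
    (C := K * (dist x y * Real.exp (L * a))) fun s hs => ?_).trans_eq ?_
  · rw [uIoc_of_le ha] at hs
    rw [← dist_eq_norm]
    refine (hφ.dist_le_mul _ _).trans ?_
    gcongr
    refine (hΦ.dist_le _ _ s hs.1.le).trans ?_
    gcongr
    exact hs.2
  · rw [sub_zero, abs_of_nonneg ha]; ring

/-- A probability measure annihilating all derivatives along `f` is invariant under the semiflow
of `f`. -/
theorem IsSemiflow.map_eq [FiniteDimensional ℝ E] [MeasurableSpace E] [BorelSpace E]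
    (hΦ : IsSemiflow f L Φ) (hf : LipschitzWith L f) {ν : Measure E} [IsProbabilityMeasure ν]
    (hν : ∀ φ : E → ℝ, ContDiff ℝ 1 φ → ∫ x, fderiv ℝ φ x (f x) ∂ν = 0) {a : ℝ} (ha : 0 ≤ a) :
    ν.map (Φ a) = ν := by
  have : CompleteSpace E := FiniteDimensional.complete ℝ E
  have hΦa := hΦ.continuous_apply ha
  have : IsProbabilityMeasure (ν.map (Φ a)) :=
    Measure.isProbabilityMeasure_map hΦa.measurable.aemeasurable
  have key : ∀ φ : E → ℝ, (∃ C, ∀ x y, dist (φ x) (φ y) ≤ C) → (∃ K, LipschitzWith K φ) →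
      ∫ x, φ x ∂ν.map (Φ a) = ∫ x, φ x ∂ν := by
    rintro φ ⟨C, hC⟩ ⟨K, hK⟩
    rw [integral_map hΦa.measurable.aemeasurable hK.continuous.aestronglyMeasurable]
    have hbdd : ∀ x, ‖φ x‖ ≤ ‖φ 0‖ + C := fun x => by
      have := hC x 0
      rw [dist_eq_norm] at this
      linarith [norm_le_norm_add_norm_sub' (φ x) (φ 0)]
    have hi1 : Integrable φ ν := Integrable.of_bound hK.continuous.aestronglyMeasurable _
      (.of_forall hbdd)
    have hi2 : Integrable (fun x => φ (Φ a x)) ν :=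
      Integrable.of_bound (hK.continuous.comp hΦa).aestronglyMeasurable _
        (.of_forall fun x => hbdd _)
    rw [← sub_eq_zero, ← integral_sub hi2 hi1, ← abs_eq_zero]
    set D := K * Real.exp (L * (a + 1)) * (2 * a * L * Real.exp (L * (a + 1)) + 4) with hD
    have hD0 : 0 ≤ D := by positivity
    have hle : ∀ ε : ℝ, 0 < ε → |∫ x, (φ (Φ a x) - φ x) ∂ν| ≤ D * ε := fun ε hε => by
      obtain ⟨ψ, hψ, hψg⟩ := exists_contDiff_abs_fderiv_sub_le (hΦ.continuous_integral hK ha) hε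
        (hΦ.eventually_abs_sub_le hf hK ha hε)
      have hmeas : AEStronglyMeasurable (fun x => fderiv ℝ ψ x (f x) - (φ (Φ a x) - φ x)) ν :=
        (((hψ.continuous_fderiv one_ne_zero).clm_apply hf.continuous).sub
          ((hK.continuous.comp hΦa).sub hK.continuous)).aestronglyMeasurable
      have hi3 : Integrable (fun x => fderiv ℝ ψ x (f x) - (φ (Φ a x) - φ x)) ν :=
        Integrable.of_bound hmeas _ (.of_forall hψg)
      have hi4 : Integrable (fun x => fderiv ℝ ψ x (f x)) ν := by
        refine (hi3.add (hi2.sub hi1)).congr (.of_forall fun x => ?_)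
        simp
      have h1 := norm_integral_le_of_norm_le_const (μ := ν)
        (f := fun x => fderiv ℝ ψ x (f x) - (φ (Φ a x) - φ x)) (.of_forall hψg)
      rw [integral_sub (g := fun x => φ (Φ a x) - φ x) hi4 (hi2.sub hi1), hν ψ hψ, zero_sub, norm_neg,
        Real.norm_eq_abs] at h1
      simpa using h1
    refine le_antisymm (le_of_forall_pos_le_add fun δ hδ => ?_) (abs_nonneg _)
    refine (hle (δ / (D + 1)) (by positivity)).trans ?_
    rw [zero_add, mul_div_assoc', div_le_iff₀ (by positivity)]
    nlinarith
  let P : ProbabilityMeasure E := ⟨ν.map (Φ a), inferInstance⟩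
  let Q : ProbabilityMeasure E := ⟨ν, inferInstance⟩
  have hlim : Tendsto (fun _ : ℕ => P) atTop (𝓝 Q) := by
    rw [tendsto_iff_forall_lipschitz_integral_tendsto]
    intro φ h1 h2
    have := key φ h1 h2
    simp only [P, Q, ProbabilityMeasure.coe_mk]
    rw [this]
    exact tendsto_const_nhds
  have hPQ : P = Q := tendsto_nhds_unique tendsto_const_nhds hlim
  exact congrArg Subtype.val hPQ

end Invariance

section Occupation

variable {E : Type*} [NormedAddCommGroup E] [NormedSpace ℝ E] {f : E → E} {L : ℝ≥0}
  {Φ : ℝ → E → E}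

/-- If the semiflow preserves `ν` and `ν`-almost every orbit is a time shift by at most `T` of the
trajectory `y`, then `y` spends at least the time `(S - T) ν(B)` in `B` during `(0, S]`. -/
theorem IsSemiflow.ofReal_mul_le_volume [FiniteDimensional ℝ E] [MeasurableSpace E]
    [BorelSpace E] (hΦ : IsSemiflow f L Φ) {ν : Measure E} [IsProbabilityMeasure ν]
    (hν : ∀ a, 0 ≤ a → ν.map (Φ a) = ν) {y : ℝ → E} {T S : ℝ}
    (hy : ∀ᵐ x ∂ν, ∃ r ∈ Icc 0 T, ∀ t, 0 ≤ t → Φ t x = y (t + r)) {B : Set E}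
    (hB : MeasurableSet B) :
    ENNReal.ofReal (S - T) * ν B ≤ volume (Ioc 0 S ∩ y ⁻¹' B) := by
  have : ProperSpace E := FiniteDimensional.proper ℝ E
  have hmeas : Measurable (Function.uncurry fun (t : ℝ) x => Φ (max t 0) x) :=
    measurable_uncurry_of_continuous_of_measurable
      (fun x => (hΦ.continuous x).comp (continuous_id.max continuous_const))
      (fun t => (hΦ.continuous_apply (le_max_right _ _)).measurable)
  have hle : ∀ᵐ x ∂ν, ∫⁻ t in Ioc 0 (S - T), B.indicator 1 (Φ (max t 0) x) ≤
      volume (Ioc 0 S ∩ y ⁻¹' B) := by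
    filter_upwards [hy] with x hx
    obtain ⟨r, hr, hxr⟩ := hx
    have hmx : Measurable fun t => Φ (max t 0) x := hmeas.of_uncurry_right
    calc ∫⁻ t in Ioc 0 (S - T), B.indicator 1 (Φ (max t 0) x)
        = ∫⁻ t in Ioc 0 (S - T), ((fun t => Φ (max t 0) x) ⁻¹' B).indicator 1 t := rfl
      _ = volume (((fun t => Φ (max t 0) x) ⁻¹' B) ∩ Ioc 0 (S - T)) := by
          rw [lintegral_indicator_one (hmx hB), Measure.restrict_apply (hmx hB)]
      _ ≤ volume ((fun t => t + r) ⁻¹' (Ioc 0 S ∩ y ⁻¹' B)) := by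
          refine measure_mono fun t ht => ⟨⟨?_, ?_⟩, ?_⟩
          · linarith [ht.2.1, hr.1]
          · linarith [ht.2.2, hr.2]
          · have h1 : Φ (max t 0) x ∈ B := ht.1
            rw [max_eq_left ht.2.1.le, hxr t ht.2.1.le] at h1
            exact h1
      _ = _ := measure_preimage_add_right _ _ _
  calc ENNReal.ofReal (S - T) * ν B
      = ∫⁻ t in Ioc 0 (S - T), ∫⁻ x, B.indicator 1 (Φ (max t 0) x) ∂ν := by
        have : ∀ t : ℝ, ∫⁻ x, B.indicator 1 (Φ (max t 0) x) ∂ν = ν B := fun t => by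
          have hm := (hΦ.continuous_apply (le_max_right t 0)).measurable
          rw [← lintegral_map (f := B.indicator 1) (measurable_one.indicator hB) hm,
            hν _ (le_max_right _ _), lintegral_indicator_one hB]
        simp only [this, lintegral_const, Measure.restrict_apply_univ, Real.volume_Ioc, sub_zero]
        rw [mul_comm]
    _ = ∫⁻ x, (∫⁻ t in Ioc 0 (S - T), B.indicator 1 (Φ (max t 0) x)) ∂ν :=
        lintegral_lintegral_swap
          ((measurable_one.indicator hB).comp hmeas).aemeasurable
    _ ≤ ∫⁻ _, volume (Ioc 0 S ∩ y ⁻¹' B) ∂ν := lintegral_mono_ae hle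
    _ = _ := by simp

end Occupation

section Splitting

theorem exists_measurableSet_volume_eq {A : Set ℝ} {S : ℝ} (hA : MeasurableSet A)
    (hAS : A ⊆ Ioc 0 S) {c : ℝ≥0∞} (hc : c ≤ volume A) :
    ∃ A' ⊆ A, MeasurableSet A' ∧ volume A' = c := by
  rcases le_or_gt 0 S with hS | hS
  swap
  · have : A = ∅ := subset_empty_iff.1 (by rwa [Ioc_eq_empty (by linarith)] at hAS)
    refine ⟨A, Subset.rfl, hA, ?_⟩
    subst this
    simpa [eq_comm] using hc
  have hfin : ∀ t, volume (A ∩ Iic t) ≠ ∞ := fun t =>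
    ((measure_mono (inter_subset_left.trans hAS)).trans_lt measure_Ioc_lt_top).ne
  have hAfin : volume A ≠ ∞ := ((measure_mono hAS).trans_lt measure_Ioc_lt_top).ne
  have hcont : Continuous fun t => volume.real (A ∩ Iic t) := by
    refine LipschitzWith.continuous (K := 1) (LipschitzWith.of_le_add_mul _ fun s t => ?_)
    have h1 : A ∩ Iic s ⊆ (A ∩ Iic t) ∪ Ioc t s := fun x hx => by
      rcases le_or_gt x t with h | h
      · exact .inl ⟨hx.1, h⟩
      · exact .inr ⟨h, hx.2⟩
    have h2 : volume.real (A ∩ Iic s) ≤ volume.real (A ∩ Iic t) + volume.real (Ioc t s) :=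
      (measureReal_mono h1 (measure_union_lt_top (hfin t).lt_top measure_Ioc_lt_top).ne).trans
        (measureReal_union_le _ _)
    have h3 : volume.real (Ioc t s) ≤ dist s t := by
      rw [Real.volume_real_Ioc, Real.dist_eq]
      exact max_le (le_abs_self _) (abs_nonneg _)
    simpa using h2.trans (by gcongr)
  have hc' : c ≠ ∞ := (hc.trans_lt hAfin.lt_top).ne
  have h0 : A ∩ Iic 0 = ∅ := by
    refine eq_empty_of_forall_notMem fun x hx => ?_
    exact absurd (hAS hx.1).1 (not_lt.2 hx.2)
  have hS' : A ∩ Iic S = A := inter_eq_left.2 fun x hx => (hAS hx).2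
  obtain ⟨t, -, ht⟩ := intermediate_value_Icc hS hcont.continuousOn
    (show c.toReal ∈ _ by
      simp only [h0, hS', measureReal_empty]
      exact ⟨ENNReal.toReal_nonneg, ENNReal.toReal_mono hAfin hc⟩)
  exact ⟨A ∩ Iic t, inter_subset_left, hA.inter measurableSet_Iic,
    (ENNReal.toReal_eq_toReal_iff' (hfin t) hc').1 ht⟩

/-- A bounded measurable subset of the line can be split into measurable pieces of prescribed
measures. -/
theorem exists_measurable_forall_le_volume {ι : Type*} [MeasurableSpace ι] [DecidableEq ι]
    [Nonempty ι] {S : ℝ} (w : ι → ℝ≥0∞) (s : Finset ι) :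
    ∀ {A : Set ℝ}, MeasurableSet A → A ⊆ Ioc 0 S → ∑ i ∈ s, w i ≤ volume A →
      ∃ v : ℝ → ι, Measurable v ∧ ∀ i ∈ s, w i ≤ volume (A ∩ v ⁻¹' {i}) := by
  classical
  induction s using Finset.induction_on with
  | empty => exact fun _ _ _ => ⟨fun _ => Classical.arbitrary ι, measurable_const, by simp⟩
  | insert i s hi ih =>
    intro A hA hAS hw
    rw [Finset.sum_insert hi] at hw
    obtain ⟨A', hA'A, hA', hvol⟩ :=
      exists_measurableSet_volume_eq hA hAS (le_self_add.trans hw)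
    have hwi : w i ≠ ∞ := by
      rw [← hvol]
      exact ((measure_mono (hA'A.trans hAS)).trans_lt measure_Ioc_lt_top).ne
    have hsum : ∑ j ∈ s, w j ≤ volume (A \ A') := by
      rw [measure_sdiff hA'A hA'.nullMeasurableSet (by rwa [hvol]), hvol]
      exact ENNReal.le_sub_of_add_le_left hwi hw
    obtain ⟨v, hv, hvs⟩ := ih (hA.diff hA') (sdiff_subset.trans hAS) hsum
    refine ⟨fun t => if t ∈ A' then i else v t, Measurable.ite hA' measurable_const hv,
      fun j hj => ?_⟩
    rcases Finset.mem_insert.1 hj with rfl | hj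
    · rw [← hvol]
      exact measure_mono fun t ht => ⟨hA'A ht, by simp [ht]⟩
    · exact (hvs j hj).trans (measure_mono fun t ht => ⟨ht.1.1, by
        have h1 : v t = j := ht.2
        simp [ht.1.2, h1]⟩)

end Splitting

section Partition

/-- A compact set admits a finite measurable partition into pieces that are close to points of the
set. -/
theorem _root_.IsCompact.exists_measurable_dist_lt {X : Type*} [MetricSpace X]
    [MeasurableSpace X] [OpensMeasurableSpace X] {K : Set X} (hK : IsCompact K)
    (hne : K.Nonempty) {ε : ℝ} (hε : 0 < ε) :
    ∃ (c : X → ℕ) (e : ℕ → X) (N : ℕ), Measurable c ∧ (∀ x, c x < N) ∧ (∀ n, e n ∈ K) ∧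
      ∀ x ∈ K, dist (e (c x)) x < ε := by
  obtain ⟨t, htK, htf, hcov⟩ := hK.finite_cover_balls hε
  have htne : t.Nonempty := by
    obtain ⟨x, hx⟩ := hne
    obtain ⟨p, hp, -⟩ := mem_iUnion₂.1 (hcov hx)
    exact ⟨p, hp⟩
  obtain ⟨e, he⟩ := htf.countable.exists_eq_range htne
  have hmem : ∀ n, e n ∈ t := fun n => he ▸ mem_range_self n
  have hidx : ∀ p ∈ t, ∃ n, e n = p := fun p hp => by rwa [he] at hp
  choose! idx hidx using hidx
  obtain ⟨N, hN⟩ := (htf.image idx).bddAbove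
  refine ⟨SimpleFunc.nearestPtInd e N, e, N + 1, SimpleFunc.measurable _,
    fun x => Nat.lt_succ_of_le (SimpleFunc.nearestPtInd_le e N x), fun n => htK (hmem n),
    fun x hx => ?_⟩
  obtain ⟨p, hp, hxp⟩ := mem_iUnion₂.1 (hcov hx)
  have h1 : edist (e (SimpleFunc.nearestPtInd e N x)) x ≤ edist (e (idx p)) x :=
    SimpleFunc.edist_nearestPt_le e x (hN (mem_image_of_mem idx hp))
  rw [hidx p hp, edist_dist, edist_dist, ENNReal.ofReal_le_ofReal_iff dist_nonneg] at h1
  exact h1.trans_lt (by rw [dist_comm]; exact hxp)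

end Partition

section Control

/-- If a trajectory `y` in `K` spends at least the time `c μ(X × B)` in every measurable set `B`,
then it can be paired with a control `u` in `U` so that `(u, y)` spends at least the time `c μ(B)`
close to every measurable set `B`. -/
theorem exists_measurable_control_mul_le_volume {X E : Type*} [MetricSpace X] [MeasurableSpace X]
    [BorelSpace X] [MetricSpace E] [MeasurableSpace E] [BorelSpace E] {U : Set X} {K : Set E}
    (hU : IsCompact U) (hK : IsCompact K) {μ : Measure (X × E)} [IsProbabilityMeasure μ]
    (hμ : μ (U ×ˢ K) = 1) {y : ℝ → E} (hy : Measurable y) {S : ℝ} (hyK : ∀ t ∈ Ioc 0 S, y t ∈ K)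
    {c : ℝ≥0∞}
    (hc : ∀ B, MeasurableSet B → c * μ (Prod.snd ⁻¹' B) ≤ volume (Ioc 0 S ∩ y ⁻¹' B))
    {ε : ℝ} (hε : 0 < ε) :
    ∃ u : ℝ → X, Measurable u ∧ (∀ t, u t ∈ U) ∧ ∀ B, MeasurableSet B →
      c * μ B ≤ volume (Ioc 0 S ∩ (fun t => (u t, y t)) ⁻¹' thickening (2 * ε) B) := by
  have hne : (U ×ˢ K).Nonempty := nonempty_of_measure_ne_zero (μ := μ) (by simp [hμ])
  obtain ⟨cU, eU, N, hcU, hcUN, heU, hdU⟩ := hU.exists_measurable_dist_lt hne.fst hε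
  obtain ⟨cK, eK, -, hcK, -, -, hdK⟩ := hK.exists_measurable_dist_lt hne.snd hε
  set q : X × E → ℕ × ℕ := fun p => (cU p.1, cK p.2) with hq_def
  have hq : Measurable q := (hcU.comp measurable_fst).prodMk (hcK.comp measurable_snd)
  have hsplit : ∀ n, ∃ v : ℝ → ℕ, Measurable v ∧ ∀ i ∈ Finset.range N,
      c * μ (q ⁻¹' {(i, n)}) ≤ volume ((Ioc 0 S ∩ y ⁻¹' (cK ⁻¹' {n})) ∩ v ⁻¹' {i}) := fun n => by
    refine exists_measurable_forall_le_volume _ _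
      (measurableSet_Ioc.inter (hy (hcK (measurableSet_singleton n)))) inter_subset_left ?_
    refine le_trans ?_ (hc _ (hcK (measurableSet_singleton n)))
    rw [← Finset.mul_sum, ← measure_biUnion_finset]
    · gcongr
      refine iUnion₂_subset fun i _ p hp => ?_
      exact congrArg Prod.snd (mem_singleton_iff.1 hp)
    · intro i _ j _ hij
      refine Disjoint.preimage _ (disjoint_singleton.2 fun h => hij (congrArg Prod.fst h))
    · exact fun i _ => hq (measurableSet_singleton _)
  choose v hv hvle using hsplit
  set w : ℝ → ℕ × ℕ := fun t => (v (cK (y t)) t, cK (y t)) with hw_def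
  have hw : Measurable w := by
    have h1 : Measurable fun p : ℝ × ℕ => v p.2 p.1 := measurable_from_prod_countable_left hv
    exact (h1.comp (measurable_id.prodMk (hcK.comp hy))).prodMk (hcK.comp hy)
  have hcell : ∀ i n, c * μ (q ⁻¹' {(i, n)}) ≤ volume (Ioc 0 S ∩ w ⁻¹' {(i, n)}) := fun i n => by
    by_cases hi : i < N
    · refine (hvle n i (Finset.mem_range.2 hi)).trans (measure_mono fun t ht => ⟨ht.1.1, ?_⟩)
      have h1 : cK (y t) = n := ht.1.2
      have h2 : v n t = i := ht.2
      simp [hw_def, h1, h2]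
    · have : q ⁻¹' {(i, n)} = ∅ := eq_empty_of_forall_notMem fun p hp => hi (by
        have h1 : cU p.1 = i := congrArg Prod.fst (mem_singleton_iff.1 hp)
        exact h1 ▸ hcUN p.1)
      simp [this]
  have hset : ∀ I : Set (ℕ × ℕ), c * μ (q ⁻¹' I) ≤ volume (Ioc 0 S ∩ w ⁻¹' I) := fun I => by
    have hI : MeasurableSet I := I.to_countable.measurableSet
    have h1 : c * μ (q ⁻¹' I) = (c • μ.map q) I := by
      rw [Measure.smul_apply, Measure.map_apply hq hI, smul_eq_mul]
    have h2 : volume (Ioc 0 S ∩ w ⁻¹' I) = (volume.restrict (Ioc 0 S)).map w I := by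
      rw [Measure.map_apply hw hI, Measure.restrict_apply (hw hI), inter_comm]
    rw [h1, h2, ← Measure.tsum_indicator_apply_singleton _ I hI,
      ← Measure.tsum_indicator_apply_singleton _ I hI]
    refine ENNReal.tsum_le_tsum fun p => indicator_le_indicator' fun _ => ?_
    have hp := measurableSet_singleton p
    rw [Measure.smul_apply, Measure.map_apply hq hp, smul_eq_mul, Measure.map_apply hw hp,
      Measure.restrict_apply (hw hp), inter_comm]
    exact hcell p.1 p.2
  refine ⟨fun t => eU (w t).1, (measurable_of_countable eU).comp hw.fst, fun t => heU _,
    fun B hB => ?_⟩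
  have hUK : MeasurableSet (U ×ˢ K) := hU.measurableSet.prod hK.measurableSet
  have hμB : μ B = μ (B ∩ U ×ˢ K) := by
    refine (measure_inter_conull ?_).symm
    exact (prob_compl_eq_zero_iff hUK).2 hμ
  calc c * μ B ≤ c * μ (q ⁻¹' (q '' (B ∩ U ×ˢ K))) := by
        rw [hμB]; gcongr; exact subset_preimage_image _ _
    _ ≤ _ := hset _
    _ ≤ _ := by
        refine measure_mono fun t ht => ⟨ht.1, ?_⟩
        obtain ⟨p, hp, hpw⟩ := ht.2
        have h1 : cU p.1 = (w t).1 := congrArg Prod.fst hpw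
        have h2 : cK p.2 = cK (y t) := congrArg Prod.snd hpw
        refine mem_thickening_iff.2 ⟨p, hp.1, ?_⟩
        rw [Prod.dist_eq]
        refine max_lt ?_ ?_
        · have h3 := hdU _ hp.2.1
          rw [h1] at h3
          change dist (eU (w t).1) p.1 < 2 * ε
          linarith
        · have h3 := hdK _ hp.2.2
          have h4 := hdK _ (hyK t ht.1)
          rw [h2] at h3
          change dist (y t) p.2 < 2 * ε
          linarith [dist_triangle_left (y t) p.2 (eK (cK (y t)))]

theorem isProbabilityMeasure_occ {u : ℝ → Dd d} {y : ℝ → Em m} (hu : Measurable u)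
    (hy : Measurable y) {S : ℝ} (hS : 0 < S) : IsProbabilityMeasure (occ u y S) := by
  refine ⟨?_⟩
  have hS' : ENNReal.ofReal S ≠ 0 := by simpa using hS
  rw [occ, Measure.smul_apply, Measure.map_apply (hu.prodMk hy) .univ]
  simp [ENNReal.inv_mul_cancel hS' ENNReal.ofReal_ne_top]

theorem exists_ρ_occ_le {U : Set (Dd d)} {K : Set (Em m)} (hU : IsCompact U) (hK : IsCompact K)
    {μ : Measure (Dd d × Em m)} [IsProbabilityMeasure μ] (hμ : μ (U ×ˢ K) = 1) {y : ℝ → Em m}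
    (hy : Measurable y) {T S : ℝ} (hT : 0 < T) (hTS : T ≤ S) (hyK : ∀ t ∈ Ioc 0 S, y t ∈ K)
    (hc : ∀ B, MeasurableSet B →
      ENNReal.ofReal (S - T) * μ (Prod.snd ⁻¹' B) ≤ volume (Ioc 0 S ∩ y ⁻¹' B))
    {ε : ℝ} (hε : 0 < ε) :
    ∃ u : ℝ → Dd d, Measurable u ∧ (∀ t, u t ∈ U) ∧
      ρ μ (occ u y S) ≤ ENNReal.ofReal (2 * ε + T / S) := by
  obtain ⟨u, hu, huU, hle⟩ := exists_measurable_control_mul_le_volume hU hK hμ hy hyK hc hε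
  have hS : 0 < S := hT.trans_le hTS
  have := isProbabilityMeasure_occ hu hy hS
  refine ⟨u, hu, huU, levyProkhorovEDist_le_of_forall_le _ _ _ fun δ B hδ hδ' hB => ?_⟩
  have hTS0 : 0 ≤ T / S := by positivity
  have hδr : 2 * ε + T / S ≤ δ.toReal := (ENNReal.ofReal_le_iff_le_toReal hδ'.ne).1 hδ.le
  have hδT : ENNReal.ofReal (T / S) ≤ δ :=
    (ENNReal.ofReal_le_ofReal (by linarith)).trans hδ.le
  have hS0 : ENNReal.ofReal S ≠ 0 := by simpa using hS
  have hocc : occ u y S (thickening δ.toReal B) = (ENNReal.ofReal S)⁻¹ *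
      volume (Ioc 0 S ∩ (fun t => (u t, y t)) ⁻¹' thickening δ.toReal B) := by
    have hm := isOpen_thickening (δ := δ.toReal) (E := B) |>.measurableSet
    rw [occ, Measure.smul_apply, Measure.map_apply (hu.prodMk hy) hm,
      Measure.restrict_apply (hu.prodMk hy hm), smul_eq_mul, inter_comm]
  calc μ B = (ENNReal.ofReal S)⁻¹ * (ENNReal.ofReal S * μ B) := by
        rw [← mul_assoc, ENNReal.inv_mul_cancel hS0 ENNReal.ofReal_ne_top, one_mul]
    _ = (ENNReal.ofReal S)⁻¹ * (ENNReal.ofReal (S - T) * μ B + ENNReal.ofReal T * μ B) := by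
        rw [← add_mul, ← ENNReal.ofReal_add (by linarith) hT.le, sub_add_cancel]
    _ ≤ (ENNReal.ofReal S)⁻¹ * (volume (Ioc 0 S ∩ (fun t => (u t, y t)) ⁻¹'
          thickening δ.toReal B) + ENNReal.ofReal T * 1) := by
        gcongr
        · refine (hle B hB).trans ?_
          gcongr
          linarith
        · exact prob_le_one
    _ = occ u y S (thickening δ.toReal B) + ENNReal.ofReal (T / S) := by
        rw [mul_add, hocc, mul_one, ENNReal.ofReal_div_of_pos hS, ENNReal.div_eq_inv_mul]
    _ ≤ _ := by gcongr

end Control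

section Uncontrolled

theorem IsSemiflow.isSolOn {f0 : Em m → Em m} {L : ℝ≥0} {Φ : ℝ → Em m → Em m}
    (hΦ : IsSemiflow f0 L Φ) (hf : LipschitzWith L f0) (x : Em m) :
    IsSolOn (fun _ x => f0 x) fun t => Φ t x :=
  ⟨(hΦ.continuous x).continuousOn,
    fun _ => (hf.continuous.comp (hΦ.continuous x)).intervalIntegrable _ _, fun t ht => by
      simpa only [hΦ.zero_apply] using hΦ.eq_integral x t ht⟩

/-- The push-forward of an element of `W` to the state space is invariant. -/
theorem IsSemiflow.map_snd_eq {U : Set (Dd d)} {f0 : Em m → Em m} {F : Em m → Kk k} {z : Kk k}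
    {L : ℝ≥0} {Φ : ℝ → Em m → Em m} (hΦ : IsSemiflow f0 L Φ) (hf : LipschitzWith L f0)
    {μ : Measure (Dd d × Em m)} (hμ : μ ∈ W U (fun _ => f0) F z) {a : ℝ} (ha : 0 ≤ a) :
    (μ.map Prod.snd).map (Φ a) = μ.map Prod.snd := by
  have := hμ.1
  have : IsProbabilityMeasure (μ.map Prod.snd) :=
    Measure.isProbabilityMeasure_map measurable_snd.aemeasurable
  refine hΦ.map_eq hf (fun φ hφ => ?_) ha
  rw [integral_map measurable_snd.aemeasurable
    ((hφ.continuous_fderiv one_ne_zero).clm_apply hf.continuous).aestronglyMeasurable]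
  exact hμ.2.2 φ hφ

/-- All forward orbits in a level set are time shifts of each other by less than a period. -/
theorem AssumptionIII.exists_shift {f0 : Em m → Em m} {F : Em m → Kk k} {Z : Set (Kk k)}
    {yper : Kk k → ℝ → Em m} {Tper : Kk k → ℝ} (hIII : AssumptionIII f0 F Z yper Tper)
    {L : ℝ≥0} {Φ : ℝ → Em m → Em m} (hΦ : IsSemiflow f0 L Φ) (hf : LipschitzWith L f0)
    {z : Kk k} (hz : z ∈ Z) {x y : Em m} (hx : x ∈ lvl F z) (hy : y ∈ lvl F z) :
    ∃ r ∈ Icc 0 (Tper z), ∀ t, 0 ≤ t → Φ t x = Φ (t + r) y := by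
  obtain ⟨⟨T₀, hT⟩, -, -, hper, huniq⟩ := hIII
  have hT0 := (hT z hz).1
  have hP : Function.Periodic (yper z) (Tper z) := hper z hz
  obtain ⟨sx, hsx⟩ := huniq z hz _ (hΦ.isSolOn hf x) (by rwa [hΦ.zero_apply])
  obtain ⟨sy, hsy⟩ := huniq z hz _ (hΦ.isSolOn hf y) (by rwa [hΦ.zero_apply])
  have hr := toIcoMod_mem_Ico' hT0 (sx - sy)
  refine ⟨toIcoMod hT0 0 (sx - sy), Ico_subset_Icc_self hr, fun t ht => ?_⟩
  rw [hsx t ht, hsy _ (add_nonneg ht hr.1), toIcoMod,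
    show t + (sx - sy - toIcoDiv hT0 0 (sx - sy) • Tper z) + sy
      = t + sx - toIcoDiv hT0 0 (sx - sy) • Tper z by ring]
  exact (hP.sub_zsmul_eq _).symm

end Uncontrolled

/-- Proposition 4.1(ii) of the paper: for an uncontrolled reduced system
satisfying Assumption III, Assumption 2 holds. -/
theorem statement9
    {d m k : ℕ}
    (Uset : Set (Dd d)) (Yset : Set (Em m)) (Zset : Set (Kk k))
    (f0 : Em m → Em m) (F : Em m → Kk k)
    (hU : IsCompact Uset) (hY : IsCompact Yset) (hZ : IsCompact Zset)
    (hfL : ∃ L : ℝ≥0, LipschitzWith L f0)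
    (hF : ∃ V : Set (Em m), IsOpen V ∧ Yset ⊆ V ∧ ContDiffOn ℝ 1 F V ∧
      ∃ LF : ℝ≥0, LipschitzOnWith LF (fun y => fderiv ℝ F y) V)
    (hInv : ∀ y ∈ Yset, fderiv ℝ F y (f0 y) = 0)
    (hYzY : ∀ z ∈ Zset, lvl F z ⊆ Yset)
    (yper : Kk k → ℝ → Em m) (Tper : Kk k → ℝ)
    (hIII : AssumptionIII f0 F Zset yper Tper) :
    Assumption2 Uset (fun _ : Dd d => f0) F Zset := by
  obtain ⟨L, hf⟩ := hfL
  obtain ⟨Φ, hΦ⟩ := exists_isSemiflow hf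
  obtain ⟨T₀, hT₀⟩ := hIII.1
  refine ⟨fun S => (2 + |T₀|) / S, tendsto_const_nhds.div_atTop tendsto_id, ?_⟩
  intro z hz y₀ hy₀ S hS μ hμ
  have : IsProbabilityMeasure μ := hμ.1
  have hK : IsCompact (lvl F z) := by
    obtain ⟨V, -, hYV, hFV, -⟩ := hF
    have h1 := (hFV.continuousOn.mono hYV).preimage_isClosed_of_isClosed hY.isClosed
      (isClosed_singleton (x := z))
    refine hY.of_isClosed_subset ?_ (hYzY z hz)
    rwa [inter_eq_right.2 (show F ⁻¹' {z} ⊆ Yset from hYzY z hz)] at h1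
  obtain ⟨u₀, hu₀, -⟩ :=
    nonempty_of_measure_ne_zero (μ := μ) (s := Uset ×ˢ lvl F z) (by simp [hμ.2.1])
  have hsol := hΦ.isSolOn hf y₀
  have hyc := hΦ.continuous y₀
  have hMz : ∀ u : ℝ → Dd d, Measurable u → (∀ t, u t ∈ Uset) →
      ρpt μ (Mz Uset (fun _ => f0) S y₀) ≤ ρ μ (occ u (fun t => Φ t y₀) S) := fun u hu huU =>
    iInf₂_le _ ⟨u, _, ⟨hu, fun t _ => huU t⟩, hsol, hΦ.zero_apply y₀, rfl⟩
  obtain ⟨hT, hTT₀⟩ := hT₀ z hz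
  have hTabs : Tper z ≤ |T₀| := hTT₀.trans (le_abs_self _)
  rcases lt_or_ge S (Tper z) with hST | hST
  · refine (hMz (fun _ => u₀.1) measurable_const fun _ => hu₀).trans ?_
    have := isProbabilityMeasure_occ (d := d) (u := fun _ => u₀.1) measurable_const
      hyc.measurable hS
    refine (levyProkhorovEDist_le_max_measure_univ _ _).trans ?_
    rw [measure_univ, measure_univ, max_self, ENNReal.one_le_ofReal, le_div_iff₀ hS]
    linarith
  · have : IsProbabilityMeasure (μ.map Prod.snd) :=
      Measure.isProbabilityMeasure_map measurable_snd.aemeasurable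
    have hmem : ∀ᵐ x ∂μ.map Prod.snd, x ∈ lvl F z := by
      refine (ae_map_iff (p := (· ∈ lvl F z)) measurable_snd.aemeasurable hK.measurableSet).2 ?_
      have h1 : ∀ᵐ p ∂μ, p ∈ Uset ×ˢ lvl F z :=
        (prob_compl_eq_zero_iff (hU.measurableSet.prod hK.measurableSet)).2 hμ.2.1
      exact h1.mono fun p hp => hp.2
    have hyK : ∀ t ∈ Ioc 0 S, Φ t y₀ ∈ lvl F z := fun t ht => by
      obtain ⟨s, hs⟩ := hIII.2.2.2.2 z hz _ hsol (by rwa [hΦ.zero_apply])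
      have h1 := hIII.2.2.1 z hz (t + s)
      rwa [← hs t ht.1.le] at h1
    obtain ⟨u, hu, huU, hle⟩ := exists_ρ_occ_le hU hK hμ.2.1 hyc.measurable hT hST hyK
      (fun B hB => by
        rw [← Measure.map_apply measurable_snd hB]
        exact hΦ.ofReal_mul_le_volume (fun a ha => hΦ.map_snd_eq hf hμ ha)
          (hmem.mono fun x hx => hIII.exists_shift hΦ hf hz hx hy₀) hB)
      (inv_pos.2 hS)
    refine (hMz u hu huU).trans (hle.trans (ENNReal.ofReal_le_ofReal ?_))
    beta_reduce
    rw [add_div, ← div_eq_mul_inv]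
    gcongr

end SlowObs
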